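/- The μ-energy form has the Markov (Dirichlet contraction) property: for every v ∈ ℝ^N, defining v̂ ∈ ℝ^N by v̂ i = min(max(v i, 0), 1), one has Σᵢ (α i)·((A·v̂) i)² ≤ Σᵢ (α i)·((A·v) i)². -/

import Mathlib

open Matrix

/-- Matrix representation of the μ-derivative ∇^μ for the discrete measure
μ = Σᵢ αᵢ δ_{zᵢ}: `A i i = -(α i)⁻¹`, `A i (i+1 mod N) = (α i)⁻¹`, all other entries `0`. -/
noncomputable def matA (N : ℕ) [NeZero N] (α : Fin N → ℝ) : Matrix (Fin N) (Fin N) ℝ :=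
  Matrix.of fun i j => if j = i then -(α i)⁻¹ else if j = i + 1 then (α i)⁻¹ else 0

/-- Matrix representation of the μ-Laplacian Δ^μ: `B = -Aᵀ·A`. -/
noncomputable def matB (N : ℕ) [NeZero N] (α : Fin N → ℝ) : Matrix (Fin N) (Fin N) ℝ :=
  -((matA N α)ᵀ * matA N α)

/-- `A` acts as the cyclic forward difference quotient. -/
theorem matA_mulVec_apply (N : ℕ) [NeZero N] (hN : 2 ≤ N) (α v : Fin N → ℝ) (i : Fin N) :
    (matA N α *ᵥ v) i = (α i)⁻¹ * (v (i + 1) - v i) := by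
  have hne : i + 1 ≠ i := by
    simpa using (show N ≠ 1 by lia)
  have hrow (j : Fin N) : matA N α i j * v j =
      (if j = i then -(α i)⁻¹ * v j else 0) + (if j = i + 1 then (α i)⁻¹ * v j else 0) := by
    by_cases h : j = i
    · subst h
      simp [matA, hne.symm]
    · simp [matA, h]
  simp only [mulVec, dotProduct, hrow, Finset.sum_add_distrib, Finset.sum_ite_eq',
    Finset.mem_univ, if_true]
  ring

/-- Truncation to `[0, 1]` is a contraction. -/
theorem sq_clamp_sub_clamp_le (a b : ℝ) :
    (min (max a 0) 1 - min (max b 0) 1) ^ 2 ≤ (a - b) ^ 2 :=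
  sq_le_sq.mpr <| (abs_min_sub_min_le_max _ _ _ _).trans <| by
    simpa using abs_max_sub_max_le_abs a b 0

/-- Markov (Dirichlet contraction) property of the μ-energy form: truncating a vector
to [0,1] does not increase its energy. -/
theorem energy_markov (N : ℕ) [NeZero N] (hN : 2 ≤ N) (α : Fin N → ℝ)
    (hα : ∀ i, 0 < α i) (v : Fin N → ℝ) :
    ∑ i, α i * ((matA N α).mulVec (fun j => min (max (v j) 0) 1) i) ^ 2 ≤
      ∑ i, α i * ((matA N α).mulVec v i) ^ 2 := by
  refine Finset.sum_le_sum fun i _ => mul_le_mul_of_nonneg_left ?_ (hα i).le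
  simp only [matA_mulVec_apply N hN, mul_pow]
  exact mul_le_mul_of_nonneg_left (sq_clamp_sub_clamp_le _ _) (sq_nonneg _)
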